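/- Let f : α → α and g : β → β be connected FDSs on finite sets whose unique cycles have the same length, i.e., the number of periodic states of f equals the number of periodic states of g. If there exists a bijection e : U(f) → U(g) that maps roots to roots and commutes with the parent maps (for every (s, k) ∈ U(f) with k ≥ 1, e(f s, k − 1) is the parent of e(s, k)), then f is isomorphic to g. -/

import Mathlib

/-- Two dynamical systems are isomorphic if there is a bijection commuting with the maps. -/
def FDSIso {α β : Type} (f : α → α) (g : β → β) : Prop :=
  ∃ e : α ≃ β, ∀ x, e (f x) = g (e x)

/-- An FDS is connected if its state set is nonempty and any two states have iterates
that meet (i.e. its functional graph is connected). -/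
def FDSConnected {α : Type} (f : α → α) : Prop :=
  Nonempty α ∧ ∀ x y : α, ∃ m n : ℕ, f^[m] x = f^[n] y

/-- A state `x` is periodic for `f` if `f^[n] x = x` for some `n ≥ 1`. -/
def IsPerState {α : Type} (f : α → α) (x : α) : Prop :=
  ∃ n, 1 ≤ n ∧ f^[n] x = x

/-- The unrolling of an FDS `f`: pairs `(s, k)` such that `f^[k] s` is periodic. -/
def Unrolling {α : Type} (f : α → α) : Type :=
  {p : α × ℕ // IsPerState f (f^[p.2] p.1)}

theorem IsPerState.iterate {α : Type} {f : α → α} {x : α} (hx : IsPerState f x) (m : ℕ) :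
    IsPerState f (f^[m] x) := by
  obtain ⟨n, hn, h⟩ := hx
  exact ⟨n, hn, Function.IsPeriodicPt.apply_iterate h m⟩

theorem IsPerState.exists_iterate_eq {α : Type} {f : α → α} {x : α} (hx : IsPerState f x)
    (m : ℕ) : ∃ y, f^[m] y = x := by
  obtain ⟨n, hn, h⟩ := hx
  refine ⟨f^[n * m - m] x, ?_⟩
  rw [← Function.iterate_add_apply, Nat.add_sub_cancel' (Nat.le_mul_of_pos_left m hn)]
  exact Function.IsPeriodicPt.mul_const h m

theorem IsPerState.eq_of_iterate_eq {α : Type} {f : α → α} {x y : α} (hx : IsPerState f x)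
    (hy : IsPerState f y) {m : ℕ} (h : f^[m] x = f^[m] y) : x = y := by
  induction m with
  | zero => exact h
  | succ m ih =>
    rw [Function.iterate_succ_apply', Function.iterate_succ_apply'] at h
    exact ih ((Function.bijOn_periodicPts f).injOn (hx.iterate m) (hy.iterate m) h)

theorem exists_lt_iterate_eq {α : Type} [Finite α] (f : α → α) :
    ∃ i j, i < j ∧ f^[i] = f^[j] := by
  obtain ⟨i, j, hij, h⟩ := Finite.exists_ne_map_eq_of_infinite (fun n : ℕ => f^[n])
  rcases hij.lt_or_gt with hlt | hlt
  · exact ⟨i, j, hlt, h⟩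
  · exact ⟨j, i, hlt, h.symm⟩

theorem isPerState_of_forall_exists_iterate_eq {α : Type} [Finite α] {f : α → α} {x : α}
    (h : ∀ m, ∃ y, f^[m] y = x) : IsPerState f x := by
  obtain ⟨i, j, hij, hf⟩ := exists_lt_iterate_eq f
  obtain ⟨y, rfl⟩ := h i
  refine ⟨j - i, by omega, ?_⟩
  rw [← Function.iterate_add_apply, Nat.sub_add_cancel hij.le, hf]

theorem FDSConnected.exists_isPerState {α : Type} [Finite α] {f : α → α} (hf : FDSConnected f) :
    ∃ x, IsPerState f x := by
  obtain ⟨⟨x⟩, -⟩ := hf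
  obtain ⟨i, j, hij, h⟩ := exists_lt_iterate_eq f
  refine ⟨f^[i] x, j - i, by omega, ?_⟩
  rw [← Function.iterate_add_apply, Nat.sub_add_cancel hij.le, h]

theorem FDSConnected.exists_iterate_eq {α : Type} {f : α → α} (hf : FDSConnected f) {r : α}
    (hr : IsPerState f r) (x : α) : ∃ k, f^[k] x = r := by
  obtain ⟨m, n, h⟩ := hf.2 x r
  obtain ⟨p, hp, h'⟩ := hr
  refine ⟨p * n - n + m, ?_⟩
  rw [Function.iterate_add_apply, h, ← Function.iterate_add_apply,
    Nat.sub_add_cancel (Nat.le_mul_of_pos_left n hp)]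
  exact Function.IsPeriodicPt.mul_const h' n

/-- In a connected FDS the unique cycle contains every periodic state. -/
theorem FDSConnected.card_isPerState {α : Type} {f : α → α} (hf : FDSConnected f) {r : α}
    (hr : IsPerState f r) : Nat.card {x : α // IsPerState f x} = Function.minimalPeriod f r := by
  have hpos : 0 < Function.minimalPeriod f r :=
    Function.minimalPeriod_pos_of_mem_periodicPts hr
  let φ : Fin (Function.minimalPeriod f r) → {x : α // IsPerState f x} :=
    fun i => ⟨f^[i] r, hr.iterate i⟩
  have hφ : Function.Bijective φ := by
    constructor
    · intro i j hij
      exact Fin.ext (Function.iterate_injOn_Iio_minimalPeriod i.2 j.2 (congrArg Subtype.val hij))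
    · rintro ⟨x, hx⟩
      obtain ⟨k, hk⟩ := hf.exists_iterate_eq hx r
      refine ⟨⟨k % Function.minimalPeriod f r, Nat.mod_lt _ hpos⟩, Subtype.ext ?_⟩
      exact Function.iterate_mod_minimalPeriod_eq.trans hk
  rw [← Nat.card_congr (Equiv.ofBijective φ hφ), Nat.card_fin]

/-- An index-preserving isomorphism of unrollings, seen as a relation: `R s k t` says that
`(s, k)` is mapped to `(t, k)`. -/
structure IsLevelCorr {α β : Type} (f : α → α) (g : β → β) (R : α → ℕ → β → Prop) : Prop where
  per_left : ∀ {s k t}, R s k t → IsPerState f (f^[k] s)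
  per_right : ∀ {s k t}, R s k t → IsPerState g (g^[k] t)
  exists_right : ∀ {s k}, IsPerState f (f^[k] s) → ∃ t, R s k t
  exists_left : ∀ {t k}, IsPerState g (g^[k] t) → ∃ s, R s k t
  unique_right : ∀ {s k t t'}, R s k t → R s k t' → t = t'
  unique_left : ∀ {s s' k t}, R s k t → R s' k t → s = s'
  parent : ∀ {s k t}, R s (k + 1) t → R (f s) k (g t)

namespace IsLevelCorr

variable {α β : Type} {f : α → α} {g : β → β} {R : α → ℕ → β → Prop}

theorem swap (h : IsLevelCorr f g R) : IsLevelCorr g f (fun t k s => R s k t) where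
  per_left := h.per_right
  per_right := h.per_left
  exists_right := h.exists_left
  exists_left := h.exists_right
  unique_right := h.unique_left
  unique_left := h.unique_right
  parent := h.parent

theorem iterate (h : IsLevelCorr f g R) {s : α} {k : ℕ} {t : β} (m : ℕ) (hR : R s (k + m) t) :
    R (f^[m] s) k (g^[m] t) := by
  induction m generalizing s t with
  | zero => exact hR
  | succ m ih => exact ih (h.parent hR)

theorem isPerState_right [Finite β] (h : IsLevelCorr f g R) {s : α} {k : ℕ} {t : β}
    (hR : R s k t) (hs : IsPerState f s) : IsPerState g t := by
  refine isPerState_of_forall_exists_iterate_eq fun m => ?_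
  obtain ⟨s', rfl⟩ := hs.exists_iterate_eq m
  have hper : IsPerState f (f^[k + m] s') := by
    rw [Function.iterate_add_apply]
    exact h.per_left hR
  obtain ⟨t', ht'⟩ := h.exists_right hper
  exact ⟨t', h.unique_right (h.iterate m ht') hR⟩

/-- If `m` is a multiple of the cycle lengths, then the copy of the root at level `m` is mapped
to the copy of the corresponding root. -/
theorem level_root [Finite β] (h : IsLevelCorr f g R) {r : α} {r' : β} (hr : R r 0 r') {m : ℕ}
    (hm : f^[m] r = r) (hm' : g^[m] r' = r') : R r m r' := by
  have hper : IsPerState f r := h.per_left hr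
  have hper' : IsPerState g r' := h.per_right hr
  obtain ⟨t, ht⟩ := h.exists_right (s := r) (k := m) (hm.symm ▸ hper)
  have htr : g^[m] t = r' := by
    have := h.iterate (k := 0) m (by rwa [Nat.zero_add])
    rw [hm] at this
    exact h.unique_right this hr
  have : t = r' := (h.isPerState_right ht hper).eq_of_iterate_eq hper' (htr.trans hm'.symm)
  rwa [this] at ht

theorem iterate_eq_root (h : IsLevelCorr f g R) {r : α} {r' : β} (hr : R r 0 r') {s : α}
    {k : ℕ} {t : β} (hR : R s k t) (hs : f^[k] s = r) : g^[k] t = r' := by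
  have := h.iterate (k := 0) k (by rwa [Nat.zero_add])
  rw [hs] at this
  exact h.unique_right this hr

theorem iterate_ne_root [Finite β] (h : IsLevelCorr f g R) {r : α} {r' : β} (hr : R r 0 r')
    (hmin : ∀ m, f^[m] r = r ↔ g^[m] r' = r') {s : α} {k : ℕ} {t : β} (hR : R s k t)
    (hs : f^[k] s = r) (hlt : ∀ j < k, f^[j] s ≠ r) : ∀ j < k, g^[j] t ≠ r' := by
  intro j hj hjt
  have hk := h.iterate_eq_root hr hR hs
  have hroot : g^[k - j] r' = r' := by
    rw [← hjt, ← Function.iterate_add_apply, Nat.sub_add_cancel hj.le, hjt, hk]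
  have hR' := h.iterate (k := k - j) j (by rwa [Nat.sub_add_cancel hj.le])
  rw [hjt] at hR'
  exact hlt j hj (h.unique_left hR' (h.level_root hr ((hmin _).2 hroot) hroot))

theorem fdsIso [Finite α] [Finite β] (h : IsLevelCorr f g R) (hf : FDSConnected f)
    (hg : FDSConnected g)
    (hcard : Nat.card {x : α // IsPerState f x} = Nat.card {y : β // IsPerState g y}) :
    FDSIso f g := by
  classical
  obtain ⟨r, hr⟩ := hf.exists_isPerState
  obtain ⟨r', hrr⟩ := h.exists_right (s := r) (k := 0) hr
  have hr' : IsPerState g r' := h.per_right hrr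
  have hmin : ∀ m, f^[m] r = r ↔ g^[m] r' = r' := fun m => by
    change Function.IsPeriodicPt f m r ↔ Function.IsPeriodicPt g m r'
    rw [Function.isPeriodicPt_iff_minimalPeriod_dvd, Function.isPeriodicPt_iff_minimalPeriod_dvd,
      ← hf.card_isPerState hr, ← hg.card_isPerState hr', hcard]
  have first : ∀ s, ∃ k, f^[k] s = r ∧ ∀ j < k, f^[j] s ≠ r := fun s =>
    have hs := hf.exists_iterate_eq hr s
    ⟨Nat.find hs, Nat.find_spec hs, fun _ hj => Nat.find_min hs hj⟩
  have first' : ∀ t, ∃ k, g^[k] t = r' ∧ ∀ j < k, g^[j] t ≠ r' := fun t =>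
    have ht := hg.exists_iterate_eq hr' t
    ⟨Nat.find ht, Nat.find_spec ht, fun _ hj => Nat.find_min ht hj⟩
  have first_unique : ∀ {γ : Type} {u : γ → γ} {x c : γ} {k l : ℕ}, u^[k] x = c →
      (∀ j < k, u^[j] x ≠ c) → u^[l] x = c → (∀ j < l, u^[j] x ≠ c) → k = l := by
    intro γ u x c k l hk hk' hl hl'
    rcases lt_trichotomy k l with hlt | heq | hlt
    · exact absurd hk (hl' k hlt)
    · exact heq
    · exact absurd hl (hk' l hlt)
  choose k hk hklt using first
  have hφ : ∀ s, ∃ t, R s (k s) t := fun s => h.exists_right ((hk s).symm ▸ hr)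
  choose φ hφ using hφ
  have hkφ : ∀ s, g^[k s] (φ s) = r' := fun s => h.iterate_eq_root hrr (hφ s) (hk s)
  have hkφlt : ∀ s, ∀ j < k s, g^[j] (φ s) ≠ r' := fun s =>
    h.iterate_ne_root hrr hmin (hφ s) (hk s) (hklt s)
  have hinj : Function.Injective φ := by
    intro s s' hss
    have hkk : k s = k s' :=
      first_unique (hkφ s) (hkφlt s) (hss ▸ hkφ s') (hss ▸ hkφlt s')
    have h1 := hφ s
    rw [hkk, hss] at h1
    exact h.unique_left h1 (hφ s')
  have hsurj : Function.Surjective φ := by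
    intro t
    obtain ⟨l, hl, hllt⟩ := first' t
    obtain ⟨s, hs⟩ := h.exists_left (t := t) (k := l) (hl.symm ▸ hr')
    have hks : k s = l := first_unique (hk s) (hklt s)
      (h.swap.iterate_eq_root hrr hs hl)
      (h.swap.iterate_ne_root hrr (fun m => (hmin m).symm) hs hl hllt)
    exact ⟨s, h.unique_right (hφ s) (hks ▸ hs)⟩
  refine ⟨Equiv.ofBijective φ ⟨hinj, hsurj⟩, fun s => ?_⟩
  change φ (f s) = g (φ s)
  rcases hks : k s with _ | m
  · have hsr : s = r := by simpa [hks] using hk s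
    have hφs : φ s = r' := by simpa [hks] using hkφ s
    rw [hφs]
    have hfs : IsPerState f (f s) := by
      rw [hsr]
      exact hr.iterate 1
    refine (h.isPerState_right (hφ (f s)) hfs).eq_of_iterate_eq (hr'.iterate 1)
      (m := k (f s)) ?_
    have hcycle : f^[k (f s) + 1] r = r := by
      rw [Function.iterate_succ_apply, ← hsr, hk, hsr]
    exact (hkφ (f s)).trans ((hmin _).1 hcycle).symm
  · have hkf : k (f s) = m := by
      refine first_unique (hk (f s)) (hklt (f s)) ?_ fun j hj => ?_
      · rw [← Function.iterate_succ_apply, Nat.succ_eq_add_one, ← hks, hk]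
      · rw [← Function.iterate_succ_apply]
        exact hklt s (j + 1) (by omega)
    have h1 := hφ s
    rw [hks] at h1
    have h2 := hφ (f s)
    rw [hkf] at h2
    exact h.unique_right h2 (h.parent h1)

end IsLevelCorr

/-- A root-preserving isomorphism between unrollings with equally many roots preserves indices. -/
theorem unrolling_index_eq {α β : Type} [Finite β] {f : α → α} {g : β → β}
    (hcard : Nat.card {x : α // IsPerState f x} = Nat.card {y : β // IsPerState g y})
    (e : Unrolling f ≃ Unrolling g)
    (hroots : ∀ p : Unrolling f, p.1.2 = 0 → (e p).1.2 = 0)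
    (hparent : ∀ p q : Unrolling f, 1 ≤ p.1.2 →
      q.1 = (f p.1.1, p.1.2 - 1) → (e q).1 = (g (e p).1.1, (e p).1.2 - 1))
    (p : Unrolling f) : (e p).1.2 = p.1.2 := by
  let root : {x : α // IsPerState f x} → Unrolling f := fun x => ⟨(x.1, 0), x.2⟩
  have hroot : ∀ x, (e (root x)).1.2 = 0 := fun x => hroots _ rfl
  let ρ : {x : α // IsPerState f x} → {y : β // IsPerState g y} := fun x =>
    ⟨(e (root x)).1.1, by
      have := (e (root x)).2
      rwa [hroot x] at this⟩
  have hρ : Function.Injective ρ := by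
    intro x y hxy
    have : root x = root y := e.injective <| Subtype.ext <|
      Prod.ext (congrArg Subtype.val hxy) ((hroot x).trans (hroot y).symm)
    exact Subtype.ext (congrArg (fun p : Unrolling f => p.1.1) this)
  have hsurj := (hρ.bijective_of_nat_card_le hcard.ge).2
  have hzero : ∀ p : Unrolling f, (e p).1.2 = 0 → p.1.2 = 0 := by
    intro p hp
    have hper : IsPerState g (e p).1.1 := by
      have := (e p).2
      rwa [hp] at this
    obtain ⟨x, hx⟩ := hsurj ⟨(e p).1.1, hper⟩
    have : root x = p := e.injective <| Subtype.ext <|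
      Prod.ext (congrArg Subtype.val hx) ((hroot x).trans hp.symm)
    rw [← this]
  obtain ⟨k, hk⟩ : ∃ k, p.1.2 = k := ⟨_, rfl⟩
  induction k generalizing p with
  | zero => rw [hroots p hk, hk]
  | succ k ih =>
    let q : Unrolling f := ⟨(f p.1.1, k), by
      have := p.2
      rwa [hk] at this⟩
    have hq : (e q).1 = (g (e p).1.1, (e p).1.2 - 1) :=
      hparent p q (by omega) (by rw [hk]; rfl)
    have h1 := ih q rfl
    rw [hq] at h1
    change (e p).1.2 - 1 = k at h1
    have h2 := mt (hzero p) (by omega)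
    omega

/-- The unrolling is injective on connected FDSs with cycles of the same length:
if their unrollings are isomorphic (as forests) then the FDSs are isomorphic. -/
theorem unrolling_injective_on_connected (α β : Type) [Fintype α] [Fintype β]
    (f : α → α) (g : β → β) (hf : FDSConnected f) (hg : FDSConnected g)
    (hcard : Nat.card {x : α // IsPerState f x} = Nat.card {y : β // IsPerState g y})
    (e : Unrolling f ≃ Unrolling g)
    (hroots : ∀ p : Unrolling f, p.1.2 = 0 → (e p).1.2 = 0)
    (hparent : ∀ p q : Unrolling f, 1 ≤ p.1.2 →
      q.1 = (f p.1.1, p.1.2 - 1) → (e q).1 = (g (e p).1.1, (e p).1.2 - 1)) :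
    FDSIso f g := by
  have hindex := unrolling_index_eq hcard e hroots hparent
  let R : α → ℕ → β → Prop := fun s k t => ∃ p, p.1 = (s, k) ∧ (e p).1 = (t, k)
  have hR : IsLevelCorr f g R :=
    { per_left := by
        rintro s k t ⟨p, hp, -⟩
        simpa [hp] using p.2
      per_right := by
        rintro s k t ⟨p, -, hp⟩
        simpa [hp] using (e p).2
      exists_right := by
        intro s k hs
        exact ⟨(e ⟨(s, k), hs⟩).1.1, ⟨(s, k), hs⟩, rfl, Prod.ext rfl (hindex _)⟩
      exists_left := by
        intro t k ht
        obtain ⟨p, hp⟩ := e.surjective ⟨(t, k), ht⟩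
        have hp' : (e p).1 = (t, k) := congrArg Subtype.val hp
        exact ⟨p.1.1, p, Prod.ext rfl (by rw [← hindex, hp']), hp'⟩
      unique_right := by
        rintro s k t t' ⟨p, hp, hpt⟩ ⟨q, hq, hqt⟩
        obtain rfl : p = q := Subtype.ext (hp.trans hq.symm)
        exact congrArg Prod.fst (hpt.symm.trans hqt)
      unique_left := by
        rintro s s' k t ⟨p, hp, hpt⟩ ⟨q, hq, hqt⟩
        obtain rfl : p = q := e.injective (Subtype.ext (hpt.trans hqt.symm))
        exact congrArg Prod.fst (hp.symm.trans hq)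
      parent := by
        rintro s k t ⟨p, hp, hpt⟩
        have hs : IsPerState f (f^[k] (f s)) := by
          have := p.2
          rwa [hp] at this
        refine ⟨⟨(f s, k), hs⟩, rfl, ?_⟩
        rw [hparent p ⟨(f s, k), hs⟩ (by simp [hp]) (by simp [hp]), hpt]
        rfl }
  exact hR.fdsIso hf hg hcard
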